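/- Let k be an integer with 2 < k < N/2 and put δ = gcd(k, N). Assume either (i) δ = 1, or (ii) δ > 1, gcd(δ, 3) = 1 and N/δ is not a power of a prime number (i.e., N/δ is divisible by at least two distinct primes). Then for every A ∈ SL₂(ℤ), the power series Φ_2(A) − Φ_1(A) is nonzero, and the quotient (Φ_k(A) − Φ_1(A)) / (Φ_2(A) − Φ_1(A)), formed in the field of formal Laurent series ℚ(ζ)((q)), has all of its coefficients in ℤ[ζ]. -/

import Mathlib

/-- For an integer `x`, `Ibr N x` is the unique integer `{x}` with `0 ≤ {x} ≤ N/2` such that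
`x ≡ {x} (mod N)` or `x ≡ -{x} (mod N)`. -/
def Ibr (N : ℕ) (x : ℤ) : ℤ := min (x % (N : ℤ)) ((N : ℤ) - x % (N : ℤ))

/-- `Imu N x = μ(x) ∈ {1, -1}`: it is `1` if `x ≡ 0` or `N/2 (mod N)`, and otherwise it is the
sign such that `x ≡ μ(x)·{x} (mod N)`. -/
def Imu (N : ℕ) (x : ℤ) : ℤ := if 2 * (x % (N : ℤ)) ≤ (N : ℤ) then 1 else -1

/-- The formal power series `Φ_s(A)` (the q-expansion of `φ_s[A]₂`, `q = e^{2πiτ/N}`),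
for `A = (a b; c d) ∈ SL₂(ℤ)`:  with `s* = μ(sc)·s·d`,
`Φ_s(A) = ζ^{s*}/(1−ζ^{s*})² − Σ_{m≥1} Σ_{n≥1} n(1−ζ^{s*n})(1−ζ^{−s*n}) q^{mnN}` if `{sc} = 0`,
and `Φ_s(A) = Σ_{n≥1} n ζ^{s*n} q^{n{sc}}
  − Σ_{m≥1} Σ_{n≥1} n·(2 q^{mnN} − ζ^{s*n} q^{n(mN+{sc})} − ζ^{−s*n} q^{n(mN−{sc})})` otherwise. -/
noncomputable def Phi (N : ℕ) {K : Type*} [Field K] (ζ : K) (c d s : ℤ) : PowerSeries K :=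
  letI : TopologicalSpace K := ⊥
  let s' : ℤ := Imu N (s * c) * s * d
  let b : ℕ := (Ibr N (s * c)).toNat
  if b = 0 then
    PowerSeries.mk fun j =>
      (if j = 0 then ζ ^ s' / (1 - ζ ^ s') ^ 2 else 0) -
        ∑' (m : ℕ+) (n : ℕ+),
          if j = (m : ℕ) * (n : ℕ) * N then
            ((n : ℕ) : K) * (1 - ζ ^ (s' * (n : ℕ))) * (1 - ζ ^ (-(s' * (n : ℕ))))
          else 0
  else
    PowerSeries.mk fun j =>
      (∑' (n : ℕ+), if j = (n : ℕ) * b then ((n : ℕ) : K) * ζ ^ (s' * (n : ℕ)) else 0) -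
        ∑' (m : ℕ+) (n : ℕ+),
          ((n : ℕ) : K) *
            (2 * (if j = (m : ℕ) * (n : ℕ) * N then (1 : K) else 0) -
              ζ ^ (s' * (n : ℕ)) * (if j = (n : ℕ) * ((m : ℕ) * N + b) then (1 : K) else 0) -
              ζ ^ (-(s' * (n : ℕ))) * (if j = (n : ℕ) * ((m : ℕ) * N - b) then (1 : K) else 0))


/-- The number `x` is a multiple of `w` by an element of `R`. -/
def Dv {K : Type*} [Field K] (R : Subring K) (w x : K) : Prop := ∃ r ∈ R, x = w * r

section dv
variable {K : Type*} [Field K] {R : Subring K}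

theorem Dv.zero (w : K) : Dv R w 0 := ⟨0, R.zero_mem, by simp⟩
theorem Dv.refl (w : K) : Dv R w w := ⟨1, R.one_mem, by simp⟩
theorem Dv.add {w x y : K} (h : Dv R w x) (h' : Dv R w y) : Dv R w (x + y) := by
  obtain ⟨r, hr, rfl⟩ := h
  obtain ⟨s, hs, rfl⟩ := h'
  exact ⟨r + s, R.add_mem hr hs, by ring⟩
theorem Dv.neg {w x : K} (h : Dv R w x) : Dv R w (-x) := by
  obtain ⟨r, hr, rfl⟩ := h
  exact ⟨-r, R.neg_mem hr, by ring⟩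
theorem Dv.sub {w x y : K} (h : Dv R w x) (h' : Dv R w y) : Dv R w (x - y) := by
  rw [sub_eq_add_neg]; exact h.add h'.neg
theorem Dv.mul_left {w x a : K} (ha : a ∈ R) (h : Dv R w x) : Dv R w (a * x) := by
  obtain ⟨r, hr, rfl⟩ := h
  exact ⟨a * r, R.mul_mem ha hr, by ring⟩
theorem Dv.trans {u w x : K} (h : Dv R u w) (h' : Dv R w x) : Dv R u x := by
  obtain ⟨r, hr, rfl⟩ := h
  obtain ⟨s, hs, rfl⟩ := h'
  exact ⟨r * s, R.mul_mem hr hs, by ring⟩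
theorem Dv.mul {u v x y : K} (h : Dv R u x) (h' : Dv R v y) : Dv R (u * v) (x * y) := by
  obtain ⟨r, hr, rfl⟩ := h
  obtain ⟨s, hs, rfl⟩ := h'
  exact ⟨r * s, R.mul_mem hr hs, by ring⟩
theorem Dv.sum {ι : Type*} {w : K} (s : Finset ι) (f : ι → K) (h : ∀ i ∈ s, Dv R w (f i)) :
    Dv R w (∑ i ∈ s, f i) := by
  classical
  induction s using Finset.induction_on with
  | empty => simpa using Dv.zero w
  | insert a s ha ih =>
    rw [Finset.sum_insert ha]
    exact (h a (by simp)).add (ih fun i hi => h i (by simp [hi]))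
theorem Dv.one_iff {x : K} : Dv R 1 x ↔ x ∈ R := by simp [Dv]

theorem Dv.one_sub_pow {x : K} (hx : x ∈ R) (n : ℕ) : Dv R (1 - x) (1 - x ^ n) := by
  refine ⟨∑ i ∈ Finset.range n, x ^ i, R.sum_mem fun i _ => R.pow_mem hx i, ?_⟩
  exact (mul_neg_geom_sum x n).symm

theorem mem_zpow {x : K} (hx : x ∈ R) (hx' : x⁻¹ ∈ R) (z : ℤ) : x ^ z ∈ R := by
  obtain ⟨n, rfl | rfl⟩ := z.eq_nat_or_neg
  · simpa using R.pow_mem hx n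
  · simpa using R.pow_mem hx' n

theorem Dv.one_sub_zpow {x : K} (h0 : x ≠ 0) (hx : x ∈ R) (hx' : x⁻¹ ∈ R) (z : ℤ) :
    Dv R (1 - x) (1 - x ^ z) := by
  obtain ⟨n, rfl | rfl⟩ := z.eq_nat_or_neg
  · simpa using Dv.one_sub_pow hx n
  · have h := ((Dv.one_sub_pow hx n).mul_left (R.pow_mem hx' n)).neg
    convert h using 1
    have : x ^ n ≠ 0 := pow_ne_zero _ h0
    simp only [zpow_neg, zpow_natCast, inv_pow]
    field_simp
    ring

end dv

theorem quot_coeff {K : Type*} [Field K] (R : Subring K) (D E : PowerSeries K) (e : ℕ) (w : K)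
    (hw : w ≠ 0) (hlow : ∀ j < e, PowerSeries.coeff j D = 0)
    (hD : ∀ j, Dv R w (PowerSeries.coeff j D))
    (hE : ∀ j, Dv R w (PowerSeries.coeff j E))
    (hwe : Dv R (PowerSeries.coeff e D) w) :
    D ≠ 0 ∧ ∀ i : ℤ, ((E : LaurentSeries K) / (D : LaurentSeries K)).coeff i ∈ R := by
  have he0 : PowerSeries.coeff e D ≠ 0 := by
    intro h
    obtain ⟨r, -, hr⟩ := hwe
    rw [h, zero_mul] at hr
    exact hw hr
  have hD0 : D ≠ 0 := by
    rintro rfl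
    simp at he0
  refine ⟨hD0, ?_⟩
  choose u hu hDu using hD
  choose v hv hEv using hE
  obtain ⟨r, hr, hwr⟩ := hwe
  let U : PowerSeries R := PowerSeries.mk fun j => ⟨u (j + e), hu _⟩
  let V : PowerSeries R := PowerSeries.mk fun j => ⟨v j, hv _⟩
  have hU : IsUnit U := by
    rw [PowerSeries.isUnit_iff_constantCoeff]
    refine IsUnit.of_mul_eq_one ⟨r, hr⟩ ?_
    apply Subtype.ext
    have h2 := hDu e
    simp only [U, ← PowerSeries.coeff_zero_eq_constantCoeff_apply, PowerSeries.coeff_mk, zero_add,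
      Subring.coe_mul, Subring.coe_one]
    rw [h2] at hwr
    apply mul_left_cancel₀ hw
    linear_combination -hwr
  obtain ⟨U', hU'⟩ := hU.exists_right_inv
  have hDe : D = PowerSeries.C w * (PowerSeries.X ^ e * PowerSeries.map R.subtype U) := by
    ext j
    rw [PowerSeries.coeff_C_mul, PowerSeries.coeff_X_pow_mul']
    split_ifs with h
    · simp [U, Nat.sub_add_cancel h, hDu]
    · simp [hlow j (by omega)]
  have hEe : E = PowerSeries.C w * PowerSeries.map R.subtype V := by
    ext j
    simp [V, hEv]
  let Q := PowerSeries.map R.subtype (V * U')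
  have hQ : PowerSeries.X ^ e * E = Q * D := by
    rw [hDe, hEe]
    have : PowerSeries.map R.subtype U * PowerSeries.map R.subtype U' = 1 := by
      rw [← map_mul, hU', map_one]
    simp only [Q, map_mul]
    linear_combination (-PowerSeries.X ^ e * PowerSeries.C w * PowerSeries.map R.subtype V) * this
  have hQ' : (E : LaurentSeries K) / (D : LaurentSeries K) =
      (Q : LaurentSeries K) * HahnSeries.single (-(e : ℤ)) 1 := by
    have hDL : (D : LaurentSeries K) ≠ 0 := by
      intro h
      apply hD0
      exact HahnSeries.ofPowerSeries_injective (Γ := ℤ) (by simpa using h)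
    rw [div_eq_iff hDL]
    have h1 : HahnSeries.single (e : ℤ) (1 : K) * (E : LaurentSeries K) =
        (Q : LaurentSeries K) * D := by
      have := congrArg (HahnSeries.ofPowerSeries ℤ K) hQ
      simpa [HahnSeries.ofPowerSeries_X_pow] using this
    have h2 : HahnSeries.single (-(e : ℤ)) (1 : K) * HahnSeries.single (e : ℤ) (1 : K) = 1 := by
      rw [HahnSeries.single_mul_single]; simp
    linear_combination (-(E : LaurentSeries K)) * h2 + HahnSeries.single (-(e : ℤ)) (1 : K) * h1
  intro i
  rw [hQ']
  have := HahnSeries.coeff_mul_single_add (x := (Q : LaurentSeries K)) (r := (1 : K))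
    (a := i + e) (b := -(e : ℤ))
  rw [add_neg_cancel_right, mul_one] at this
  rw [this, PowerSeries.coeff_coe]
  split_ifs
  · exact R.zero_mem
  · simp only [Q, PowerSeries.coeff_map]
    exact SetLike.coe_mem _

/-- A finite range of positive integers sufficient for the `j`-th coefficient. -/
def Srange (j : ℕ) : Finset ℕ+ := Finset.Icc 1 (Nat.succPNat j)

theorem not_mem_Srange {j : ℕ} {n : ℕ+} (h : n ∉ Srange j) : j < (n : ℕ) := by
  by_contra hc
  apply h
  rw [Srange, Finset.mem_Icc]
  refine ⟨one_le, ?_⟩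
  rw [← PNat.coe_le_coe]
  simp only [Nat.succPNat_coe]
  omega

theorem mem_Srange {j : ℕ} {n : ℕ+} (h : (n : ℕ) ≤ j + 1) : n ∈ Srange j := by
  rw [Srange, Finset.mem_Icc]
  exact ⟨one_le, by rw [← PNat.coe_le_coe]; simpa using h⟩

/-- The part of a coefficient in the case `{sc} = 0` coming from `q^{mnN}`. -/
noncomputable def Tz {K : Type*} [Field K] (N : ℕ) (y : K) (j : ℕ) : K :=
  ∑ m ∈ Srange j, ∑ n ∈ Srange j, if j = (m : ℕ) * (n : ℕ) * N then
            ((n : ℕ) : K) * (1 - y ^ (n : ℤ)) * (1 - y ^ (-(n : ℤ))) else 0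

/-- The coefficient in the case `{sc} ≠ 0`. -/
noncomputable def Tn {K : Type*} [Field K] (N b : ℕ) (y : K) (j : ℕ) : K :=
  (∑ n ∈ Srange j, if j = (n : ℕ) * b then ((n : ℕ) : K) * y ^ (n : ℤ) else 0) -
  ∑ m ∈ Srange j, ∑ n ∈ Srange j, ((n : ℕ) : K) *
            (2 * (if j = (m : ℕ) * (n : ℕ) * N then (1 : K) else 0) -
              y ^ (n : ℤ) * (if j = (n : ℕ) * ((m : ℕ) * N + b) then (1 : K) else 0) -
              y ^ (-(n : ℤ)) * (if j = (n : ℕ) * ((m : ℕ) * N - b) then (1 : K) else 0))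

theorem coeff_Phi_zero {K : Type*} [Field K] (N : ℕ) (hN : 0 < N) (ζ : K) (c d s : ℤ)
    (hb : (Ibr N (s * c)).toNat = 0) (j : ℕ) :
    PowerSeries.coeff j (Phi N ζ c d s) =
      (if j = 0 then ζ ^ (Imu N (s * c) * s * d) / (1 - ζ ^ (Imu N (s * c) * s * d)) ^ 2 else 0)
        - Tz N (ζ ^ (Imu N (s * c) * s * d)) j := by
  unfold Phi Tz
  simp only [hb, if_true, PowerSeries.coeff_mk]
  let _ : TopologicalSpace K := ⊥
  congr 1
  have hin : ∀ m : ℕ+, (∑' (n : ℕ+), if j = (m : ℕ) * (n : ℕ) * N then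
            ((n : ℕ) : K) * (1 - ζ ^ ((Imu N (s * c) * s * d) * (n : ℕ))) *
              (1 - ζ ^ (-((Imu N (s * c) * s * d) * (n : ℕ)))) else 0) =
      ∑ n ∈ Srange j, if j = (m : ℕ) * (n : ℕ) * N then
            ((n : ℕ) : K) * (1 - (ζ ^ (Imu N (s * c) * s * d)) ^ (n : ℤ)) *
              (1 - (ζ ^ (Imu N (s * c) * s * d)) ^ (-(n : ℤ))) else 0 := by
    intro m
    rw [tsum_eq_sum (s := Srange j)]
    · simp only [← zpow_mul, mul_neg]
    · intro n hn
      have h1 := not_mem_Srange hn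
      rw [if_neg]
      intro h
      have h2 : (n : ℕ) ≤ (m : ℕ) * n * N := by
        have := Nat.mul_le_mul (Nat.mul_le_mul m.pos (le_refl (n : ℕ))) (Nat.succ_le_of_lt hN)
        simpa using this
      omega
  simp only [hin]
  refine tsum_eq_sum (fun m hm => ?_)
  have h1 := not_mem_Srange hm
  refine Finset.sum_eq_zero fun n _ => ?_
  rw [if_neg]
  intro h
  have h2 : (m : ℕ) ≤ (m : ℕ) * n * N := by
    have := Nat.mul_le_mul (Nat.mul_le_mul (le_refl (m : ℕ)) n.pos) (Nat.succ_le_of_lt hN)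
    simpa using this
  omega

theorem aux_ne {N b j : ℕ} (hb : 0 < b) (hbN : 2 * b ≤ N) {m n : ℕ+}
    (h : j < (m : ℕ) ∨ j < (n : ℕ)) :
    j ≠ (m : ℕ) * n * N ∧ j ≠ (n : ℕ) * ((m : ℕ) * N + b) ∧ j ≠ (n : ℕ) * ((m : ℕ) * N - b) := by
  have hm := m.pos
  have hn := n.pos
  have e1 : (m : ℕ) ≤ m * N - b := by
    have : (m : ℕ) + b ≤ m * N := by
      nlinarith [Nat.mul_le_mul hm hbN, Nat.mul_le_mul hm hb, Nat.mul_le_mul_left (m : ℕ) hbN]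
    omega
  have key : ∀ t : ℕ, (m : ℕ) ≤ t → j ≠ (n : ℕ) * t := by
    intro t ht
    have a1 : t ≤ n * t := Nat.le_mul_of_pos_left _ hn
    have a2 : (n : ℕ) ≤ n * t := Nat.le_mul_of_pos_right _ (by omega)
    omega
  refine ⟨?_, key _ (by omega), key _ e1⟩
  rw [show (m : ℕ) * n * N = n * (m * N) by ring]
  exact key _ (by omega)

theorem coeff_Phi_ne {K : Type*} [Field K] (N : ℕ) (ζ : K) (c d s : ℤ) (b : ℕ)
    (hb : (Ibr N (s * c)).toNat = b) (hb0 : 0 < b) (hbN : 2 * b ≤ N) (j : ℕ) :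
    PowerSeries.coeff j (Phi N ζ c d s) = Tn N b (ζ ^ (Imu N (s * c) * s * d)) j := by
  unfold Phi Tn
  simp only [hb, if_neg hb0.ne', PowerSeries.coeff_mk]
  let _ : TopologicalSpace K := ⊥
  simp only [← zpow_mul, mul_neg]
  congr 1
  · refine tsum_eq_sum fun n hn => ?_
    have h1 := not_mem_Srange hn
    rw [if_neg]
    intro h
    have a2 : (n : ℕ) ≤ n * b := Nat.le_mul_of_pos_right _ hb0
    omega
  · have hin : ∀ m : ℕ+, (∑' (n : ℕ+), ((n : ℕ) : K) *
            (2 * (if j = (m : ℕ) * (n : ℕ) * N then (1 : K) else 0) -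
              ζ ^ (Imu N (s * c) * s * d * (n : ℕ)) *
                (if j = (n : ℕ) * ((m : ℕ) * N + b) then (1 : K) else 0) -
              ζ ^ (-(Imu N (s * c) * s * d * (n : ℕ))) *
                (if j = (n : ℕ) * ((m : ℕ) * N - b) then (1 : K) else 0))) =
         ∑ n ∈ Srange j, ((n : ℕ) : K) *
            (2 * (if j = (m : ℕ) * (n : ℕ) * N then (1 : K) else 0) -
              ζ ^ (Imu N (s * c) * s * d * (n : ℕ)) *
                (if j = (n : ℕ) * ((m : ℕ) * N + b) then (1 : K) else 0) -
              ζ ^ (-(Imu N (s * c) * s * d * (n : ℕ))) *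
                (if j = (n : ℕ) * ((m : ℕ) * N - b) then (1 : K) else 0)) := by
      intro m
      refine tsum_eq_sum fun n hn => ?_
      obtain ⟨h1, h2, h3⟩ := aux_ne hb0 hbN (m := m) (n := n) (Or.inr (not_mem_Srange hn))
      simp [h1, h2, h3]
    simp only [hin]
    refine tsum_eq_sum fun m hm => Finset.sum_eq_zero fun n _ => ?_
    obtain ⟨h1, h2, h3⟩ := aux_ne hb0 hbN (m := m) (n := n) (Or.inl (not_mem_Srange hm))
    simp [h1, h2, h3]

section T
variable {K : Type*} [Field K] {R : Subring K}

theorem Tz_zero {N : ℕ} (hN : 0 < N) (y : K) : Tz N y 0 = 0 := by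
  unfold Tz
  refine Finset.sum_eq_zero fun m _ => Finset.sum_eq_zero fun n _ => ?_
  rw [if_neg]
  have := Nat.mul_pos (Nat.mul_pos m.pos n.pos) hN
  omega

theorem Tz_mem {N : ℕ} {y : K} (hy : y ∈ R) (hy' : y⁻¹ ∈ R) (j : ℕ) : Tz N y j ∈ R := by
  unfold Tz
  refine R.sum_mem fun m _ => R.sum_mem fun n _ => ?_
  split_ifs
  · exact R.mul_mem (R.mul_mem (natCast_mem R _) (R.sub_mem R.one_mem (mem_zpow hy hy' _)))
      (R.sub_mem R.one_mem (mem_zpow hy hy' _))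
  · exact R.zero_mem

theorem Tz_sub {N : ℕ} {y z w : K} (j : ℕ)
    (h : ∀ n : ℕ, Dv R w ((1 - y ^ (n : ℤ)) * (1 - y ^ (-(n : ℤ))) -
      (1 - z ^ (n : ℤ)) * (1 - z ^ (-(n : ℤ))))) :
    Dv R w (Tz N y j - Tz N z j) := by
  unfold Tz
  simp only [← Finset.sum_sub_distrib]
  refine Dv.sum _ _ fun m _ => Dv.sum _ _ fun n _ => ?_
  split_ifs
  · have := (h n).mul_left (natCast_mem R (n : ℕ))
    convert this using 1
    ring
  · simpa using Dv.zero w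

theorem Tn_mem {N b : ℕ} {y : K} (hy : y ∈ R) (hy' : y⁻¹ ∈ R) (j : ℕ) : Tn N b y j ∈ R := by
  have hi : ∀ P : Prop, ∀ [Decidable P], (if P then (1 : K) else 0) ∈ R := by
    intro P _
    split_ifs
    · exact R.one_mem
    · exact R.zero_mem
  unfold Tn
  refine R.sub_mem (R.sum_mem fun n _ => ?_) (R.sum_mem fun m _ => R.sum_mem fun n _ => ?_)
  · split_ifs
    · exact R.mul_mem (natCast_mem R _) (mem_zpow hy hy' _)
    · exact R.zero_mem
  · refine R.mul_mem (natCast_mem R _) (R.sub_mem (R.sub_mem ?_ ?_) ?_)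
    · exact R.mul_mem (ofNat_mem R 2) (hi _)
    · exact R.mul_mem (mem_zpow hy hy' _) (hi _)
    · exact R.mul_mem (mem_zpow hy hy' _) (hi _)

theorem Tn_sub {N b : ℕ} {y z w : K} (j : ℕ) (h : ∀ n : ℤ, Dv R w (y ^ n - z ^ n)) :
    Dv R w (Tn N b y j - Tn N b z j) := by
  have hi : ∀ P : Prop, ∀ [Decidable P], (if P then (1 : K) else 0) ∈ R := by
    intro P _
    split_ifs
    · exact R.one_mem
    · exact R.zero_mem
  unfold Tn
  rw [sub_sub_sub_comm]
  apply Dv.sub <;> simp only [← Finset.sum_sub_distrib]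
  on_goal 1 => refine Dv.sum _ _ fun n _ => ?_
  on_goal 2 => refine Dv.sum _ _ fun m _ => Dv.sum _ _ fun n _ => ?_
  · split_ifs
    · rw [← mul_sub]
      exact (h _).mul_left (natCast_mem R _)
    · simpa using Dv.zero w
  · have h1 := ((h n).mul_left (hi (j = (n : ℕ) * ((m : ℕ) * N + b)))).neg
    have h2 := ((h (-(n : ℤ))).mul_left (hi (j = (n : ℕ) * ((m : ℕ) * N - b))))
    have := (h1.sub h2).mul_left (natCast_mem R (n : ℕ))
    convert this using 1
    ring

theorem Tn_low {N b j : ℕ} (hbN : 2 * b ≤ N) (hj : j < b) (y : K) : Tn N b y j = 0 := by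
  unfold Tn
  have hle : ∀ (n : ℕ+) (t : ℕ), b ≤ t → j ≠ (n : ℕ) * t := by
    intro n t ht
    have a1 : t ≤ n * t := Nat.le_mul_of_pos_left _ n.pos
    omega
  rw [Finset.sum_eq_zero, Finset.sum_eq_zero, sub_zero]
  · intro m _
    refine Finset.sum_eq_zero fun n _ => ?_
    have hm : N ≤ m * N := Nat.le_mul_of_pos_left _ m.pos
    rw [if_neg, if_neg (hle n _ (by omega)), if_neg (hle n _ (by omega))]
    · simp
    · rw [show (m : ℕ) * n * N = n * (m * N) by ring]
      exact hle n _ (by omega)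
  · intro n _
    rw [if_neg (hle n _ le_rfl)]

theorem Tn_lead {N b : ℕ} (hb : 0 < b) (hbN : 2 * b < N) (y : K) : Tn N b y b = y := by
  unfold Tn
  have hle : ∀ (n : ℕ+) (t : ℕ), b < t → b ≠ (n : ℕ) * t := by
    intro n t ht
    have a1 : t ≤ n * t := Nat.le_mul_of_pos_left _ n.pos
    omega
  rw [Finset.sum_eq_single (1 : ℕ+), Finset.sum_eq_zero, sub_zero]
  · simp
  · intro m _
    refine Finset.sum_eq_zero fun n _ => ?_
    have hm : N ≤ m * N := Nat.le_mul_of_pos_left _ m.pos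
    rw [if_neg, if_neg (hle n _ (by omega)), if_neg (hle n _ (by omega))]
    · simp
    · rw [show (m : ℕ) * n * N = n * (m * N) by ring]
      exact hle n _ (by omega)
  · intro n _ hn
    rw [if_neg]
    intro h
    apply hn
    have : (n : ℕ) = 1 := by
      have : 1 * b = n * b := by omega
      exact (Nat.eq_of_mul_eq_mul_right hb this).symm
    exact PNat.coe_eq_one_iff.mp this
  · intro h
    exact absurd (mem_Srange (by simp)) h

end T

section arith

theorem Ibr_nonneg {N : ℕ} (hN : 0 < N) (x : ℤ) : 0 ≤ Ibr N x := by
  unfold Ibr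
  have := Int.emod_nonneg x (by omega : (N : ℤ) ≠ 0)
  have := Int.emod_lt_of_pos x (by omega : 0 < (N : ℤ))
  omega

theorem Ibr_le {N : ℕ} (x : ℤ) : 2 * Ibr N x ≤ N := by
  unfold Ibr
  omega

theorem Imu_cases (N : ℕ) (x : ℤ) : Imu N x = 1 ∨ Imu N x = -1 := by
  unfold Imu
  split_ifs <;> simp

theorem dvd_sub_Imu (N : ℕ) (x : ℤ) : (N : ℤ) ∣ x - Imu N x * Ibr N x := by
  have h := Int.mul_ediv_add_emod x N
  unfold Imu Ibr
  split_ifs with h1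
  · rw [min_eq_left (by omega)]
    exact ⟨x / N, by linarith⟩
  · rw [min_eq_right (by omega)]
    exact ⟨x / N + 1, by linarith⟩

theorem Ibr_unique {N : ℕ} {x r : ℤ} (hr : 0 < r) (hrN : 2 * r < N) {ε : ℤ}
    (hε : ε = 1 ∨ ε = -1) (h : (N : ℤ) ∣ x - ε * r) : Ibr N x = r ∧ Imu N x = ε := by
  obtain ⟨t, ht⟩ := h
  rcases hε with rfl | rfl
  · have hx : x % N = r := by
      rw [show x = r + N * t by linarith, Int.add_mul_emod_self_left]
      exact Int.emod_eq_of_lt hr.le (by omega)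
    unfold Ibr Imu
    rw [hx]
    exact ⟨min_eq_left (by omega), if_pos (by omega)⟩
  · have hx : x % N = N - r := by
      rw [show x = (N - r) + N * (t - 1) by linarith, Int.add_mul_emod_self_left]
      exact Int.emod_eq_of_lt (by omega) (by omega)
    unfold Ibr Imu
    rw [hx]
    exact ⟨by rw [min_eq_right (by omega)]; ring, if_neg (by omega)⟩

theorem Ibr_zero_of_dvd {N : ℕ} {x : ℤ} (h : (N : ℤ) ∣ x) : Ibr N x = 0 ∧ Imu N x = 1 := by
  have := Int.emod_eq_zero_of_dvd h
  simp [Ibr, Imu, this]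

theorem Ibr_eq_zero {N : ℕ} {x : ℤ} (h : Ibr N x = 0) : (N : ℤ) ∣ x := by
  have := dvd_sub_Imu N x
  rwa [h, mul_zero, sub_zero] at this

end arith

section main
variable {K : Type*} [Field K]

theorem prim_unit {n : ℕ} {ω : K} (R : Subring K) (hR : ω ∈ R) (hω : IsPrimitiveRoot ω n)
    {p q : ℕ} (hp : p.Prime) (hq : q.Prime) (hpq : p ≠ q) (hpn : p ∣ n) (hqn : q ∣ n)
    (hn : 0 < n) : Dv R (1 - ω) 1 := by
  classical
  have hnp : ∀ {p' : ℕ}, p'.Prime → ∀ k : ℕ, p' ^ k ≠ n := by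
    rintro p' hp' k rfl
    have h1 := (Nat.prime_dvd_prime_iff_eq hp hp').mp (hp.dvd_of_dvd_pow hpn)
    have h2 := (Nat.prime_dvd_prime_iff_eq hq hp').mp (hq.dvd_of_dvd_pow hqn)
    exact hpq (h1.trans h2.symm)
  have h1 := Polynomial.eval_one_cyclotomic_not_prime_pow (R := K) hnp
  rw [Polynomial.cyclotomic_eq_prod_X_sub_primitiveRoots hω, Polynomial.eval_prod] at h1
  have hmem : ω ∈ primitiveRoots n K := (mem_primitiveRoots hn).mpr hω
  rw [← Finset.mul_prod_erase _ _ hmem] at h1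
  simp only [Polynomial.eval_sub, Polynomial.eval_X, Polynomial.eval_C] at h1
  refine ⟨_, ?_, h1.symm⟩
  refine R.prod_mem fun μ hμ => R.sub_mem R.one_mem ?_
  have hμ' := (mem_primitiveRoots hn).mp (Finset.mem_of_mem_erase hμ)
  have : NeZero n := ⟨hn.ne'⟩
  obtain ⟨i, -, rfl⟩ := hω.eq_pow_of_pow_eq_one hμ'.pow_eq_one
  exact R.pow_mem hR i

theorem unit_k {N : ℕ} (hN : 6 < N) {ζ : K} (hζ : IsPrimitiveRoot ζ N) (R : Subring K)
    (hR : ∀ z : ℤ, ζ ^ z ∈ R) {k : ℤ}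
    (hδ : ∃ p q : ℕ, p.Prime ∧ q.Prime ∧ p ≠ q ∧
          p ∣ N / Int.gcd k N ∧ q ∣ N / Int.gcd k N)
    {a b c d : ℤ} (hA : a * d - b * c = 1) (hkc : (N : ℤ) ∣ k * c) :
    Dv R (1 - ζ ^ (k * d)) 1 := by
  obtain ⟨p, q, hp, hq, hpq, hpn, hqn⟩ := hδ
  set g := Int.gcd k N with hg
  have hg0 : 0 < g := Int.gcd_pos_of_ne_zero_right _ (by omega)
  have hgN : g ∣ N := by
    have := Int.gcd_dvd_right k N
    exact_mod_cast this
  obtain ⟨n, hn⟩ := hgN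
  obtain ⟨k', hk'⟩ : (g : ℤ) ∣ k := Int.gcd_dvd_left k N
  have hNg : N / g = n := by rw [hn]; exact Nat.mul_div_cancel_left _ hg0
  rw [hNg] at hpn hqn
  have hn0 : 0 < n := by
    rcases Nat.eq_zero_or_pos n with h | h
    · rw [h] at hn; omega
    · exact h
  have hprim := hζ.pow (by omega) hn
  have hcop : Int.gcd k' n = 1 := by
    have h1 : Int.gcd k N = g * Int.gcd k' n := by
      conv_lhs => rw [hk', hn]
      push_cast
      rw [Int.gcd_mul_left]; simp
    rw [← hg] at h1
    exact Nat.eq_of_mul_eq_mul_left hg0 (by omega)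
  have hcop' : IsCoprime k' (n : ℤ) := Int.isCoprime_iff_gcd_eq_one.mpr hcop
  have hnc : (n : ℤ) ∣ c := by
    apply hcop'.symm.dvd_of_dvd_mul_left
    have : ((g : ℤ) * n) ∣ g * (k' * c) := by
      rw [hn] at hkc; push_cast at hkc
      rw [← mul_assoc, ← hk']; exact hkc
    exact Int.dvd_of_mul_dvd_mul_left (by omega) this
  have hdn : IsCoprime d (n : ℤ) := by
    obtain ⟨t, ht⟩ := hnc
    exact ⟨a, -b * t, by rw [ht] at hA; linear_combination hA⟩
  have hall := Int.isCoprime_iff_gcd_eq_one.mp (hcop'.mul_left hdn)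
  have := hprim.zpow_of_gcd_eq_one _ hall
  have e : (ζ ^ g) ^ (k' * d) = ζ ^ (k * d) := by
    rw [← zpow_natCast ζ g, ← zpow_mul, ← mul_assoc, ← hk']
  rw [e] at this
  exact prim_unit R (hR _) this hp hq hpq hpn hqn hn0

theorem toNat_ne {N : ℕ} (hN : 0 < N) {x : ℤ} (h : ¬ (N : ℤ) ∣ x) :
    0 < (Ibr N x).toNat ∧ 2 * (Ibr N x).toNat ≤ N := by
  have h1 := Ibr_nonneg hN x
  have h2 := Ibr_le (N := N) x
  have h3 : Ibr N x ≠ 0 := fun h' => h (Ibr_eq_zero h')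
  omega

theorem Phi_int_ne {N : ℕ} (hN : 6 < N) {ζ : K} (R : Subring K) (hR : ∀ z : ℤ, ζ ^ z ∈ R)
    (c d s : ℤ) (h : ¬ (N : ℤ) ∣ s * c) (j : ℕ) : PowerSeries.coeff j (Phi N ζ c d s) ∈ R := by
  obtain ⟨h1, h2⟩ := toNat_ne (by omega) h
  rw [coeff_Phi_ne N ζ c d s _ rfl h1 h2]
  exact Tn_mem (hR _) (by rw [← zpow_neg]; exact hR _) j

theorem Phi_coeff_dvd {N : ℕ} (hN : 6 < N) (ζ : K)
    (c d s : ℤ) (h : (N : ℤ) ∣ s * c) (j : ℕ) :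
    PowerSeries.coeff j (Phi N ζ c d s) =
      (if j = 0 then ζ ^ (s * d) / (1 - ζ ^ (s * d)) ^ 2 else 0) - Tz N (ζ ^ (s * d)) j := by
  obtain ⟨h1, h2⟩ := Ibr_zero_of_dvd h
  rw [coeff_Phi_zero N (by omega) ζ c d s (by simp [h1]), h2, one_mul]

theorem Phi_int_dvd {N : ℕ} (hN : 6 < N) {ζ : K} (R : Subring K) (hR : ∀ z : ℤ, ζ ^ z ∈ R)
    (c d s : ℤ) (h : (N : ℤ) ∣ s * c) (hu : Dv R (1 - ζ ^ (s * d)) 1) (j : ℕ) :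
    PowerSeries.coeff j (Phi N ζ c d s) ∈ R := by
  rw [Phi_coeff_dvd hN ζ c d s h]
  refine R.sub_mem ?_ (Tz_mem (hR _) (by rw [← zpow_neg]; exact hR _) j)
  split_ifs
  · obtain ⟨r, hr, hr'⟩ := hu
    have h0 : 1 - ζ ^ (s * d) ≠ 0 := by
      intro h0; rw [h0] at hr'; simp at hr'
    have : ζ ^ (s * d) / (1 - ζ ^ (s * d)) ^ 2 = ζ ^ (s * d) * r ^ 2 := by
      rw [div_eq_iff (pow_ne_zero _ h0)]
      calc ζ ^ (s * d) = ζ ^ (s * d) * 1 ^ 2 := by ring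
        _ = ζ ^ (s * d) * ((1 - ζ ^ (s * d)) * r) ^ 2 := by rw [← hr']
        _ = _ := by ring
    rw [this]
    exact R.mul_mem (hR _) (R.pow_mem hr 2)
  · exact R.zero_mem

/-- Behaviour of the residues when `3c ≡ 0`. -/
theorem three_case {N : ℕ} (hN : 6 < N) {c s ε : ℤ} (h3 : (N : ℤ) ∣ 3 * c)
    (hc : ¬ (N : ℤ) ∣ 1 * c) (hε : ε = 1 ∨ ε = -1) (hs : 3 ∣ s - ε) :
    2 * Ibr N (1 * c) < N ∧ Ibr N (s * c) = Ibr N (1 * c) ∧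
      Imu N (s * c) = ε * Imu N (1 * c) := by
  have hd := dvd_sub_Imu N (1 * c)
  have hle := Ibr_le (N := N) (1 * c)
  have hnn := Ibr_nonneg (by omega : 0 < N) (1 * c)
  have hne : Ibr N (1 * c) ≠ 0 := fun h' => hc (Ibr_eq_zero h')
  have hμ := Imu_cases N (1 * c)
  set b := Ibr N (1 * c)
  set μ := Imu N (1 * c)
  have hlt : 2 * b < N := by
    rcases lt_or_eq_of_le hle with h | h
    · exact h
    exfalso
    have h4 : (N : ℤ) ∣ 3 * b := by
      have : μ * μ = 1 := by rcases hμ with h | h <;> rw [h] <;> norm_num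
      have h5 : 3 * b = μ * (3 * c) - 3 * μ * (1 * c - μ * b) := by
        linear_combination (-3 * b) * this
      rw [h5]
      exact dvd_sub (h3.mul_left _) (hd.mul_left _)
    have h6 : (N : ℤ) ∣ b := by
      have : b = 3 * b - N := by linarith
      rw [this]
      exact dvd_sub h4 dvd_rfl
    have := Int.le_of_dvd (by omega) h6
    omega
  refine ⟨hlt, ?_⟩
  apply Ibr_unique (by omega) hlt
  · rcases hμ with h | h <;> rcases hε with h' | h' <;> rw [h, h'] <;> norm_num
  · obtain ⟨t, ht⟩ := hs
    have : s * c - ε * μ * b = t * (3 * c) + ε * (1 * c - μ * b) := by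
      linear_combination c * ht
    rw [this]
    exact dvd_add (h3.mul_left _) (hd.mul_left _)

end main

section main2
variable {K : Type*} [Field K]

/-- The case `N ∣ c`. -/
theorem case_dvd {N : ℕ} (hN : 6 < N) {ζ : K} (hζ : IsPrimitiveRoot ζ N) (R : Subring K)
    (hR : ∀ z : ℤ, ζ ^ z ∈ R) (k : ℤ) (h3 : ¬ ((3 : ℤ) ∣ k ∧ (3 : ℤ) ∣ N))
    (a b c d : ℤ) (hA : a * d - b * c = 1) (hc : (N : ℤ) ∣ c)
    (hk : Int.gcd k N = 1 ∨ Dv R (1 - ζ ^ (k * d)) 1) :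
    Phi N ζ c d 2 - Phi N ζ c d 1 ≠ 0 ∧
      ∀ i : ℤ,
        (((Phi N ζ c d k - Phi N ζ c d 1 : PowerSeries K) : LaurentSeries K) /
            ((Phi N ζ c d 2 - Phi N ζ c d 1 : PowerSeries K) : LaurentSeries K)).coeff i ∈ R := by
  have hζ0 : ζ ≠ 0 := hζ.ne_zero (by omega)
  obtain ⟨η, hη⟩ : ∃ η, η = ζ ^ d := ⟨_, rfl⟩
  have hηs : ∀ s : ℤ, ζ ^ (s * d) = η ^ s := by
    intro s; rw [hη, ← zpow_mul, mul_comm]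
  have hη0 : η ≠ 0 := by rw [hη]; exact zpow_ne_zero _ hζ0
  have hηR : ∀ z : ℤ, η ^ z ∈ R := fun z => by rw [← hηs]; exact hR _
  have hηR1 : η ∈ R := by simpa using hηR 1
  have hηN : ∀ z : ℤ, η ^ ((N : ℤ) * z) = 1 := by
    intro z
    rw [← hηs, mul_assoc, zpow_mul, zpow_natCast, hζ.pow_eq_one, one_zpow]
  have hη1 : ∀ z : ℤ, η ^ z = 1 → (N : ℤ) ∣ z := by
    intro z hz
    rw [← hηs, hζ.zpow_eq_one_iff_dvd] at hz
    have : z = a * (z * d) - (z * b) * c := by linear_combination (-z) * hA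
    rw [this]
    exact dvd_sub (hz.mul_left _) (hc.mul_left _)
  have hdvz : ∀ s t : ℤ, Dv R (1 - η ^ s) (1 - η ^ (s * t)) := by
    intro s t
    rw [zpow_mul]
    exact Dv.one_sub_zpow (zpow_ne_zero _ hη0) (hηR _) (by rw [← zpow_neg]; exact hηR _) t
  have hdv1 : ∀ t : ℤ, Dv R (1 - η) (1 - η ^ t) := by
    intro t
    simpa using hdvz 1 t
  have hcopdv : ∀ s : ℤ, IsCoprime s (N : ℤ) → Dv R (1 - η ^ s) (1 - η) := by
    rintro s ⟨u, v, huv⟩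
    have h := hdvz s u
    have e : η ^ (s * u) = η := by
      rw [show s * u = 1 + N * (-v) by linear_combination huv, zpow_add₀ hη0, hηN]
      simp
    rwa [e] at h
  have hA1 : 1 - η ≠ 0 := by
    intro h
    have := Int.le_of_dvd (by norm_num) (hη1 1 (by rw [zpow_one]; exact (sub_eq_zero.mp h).symm))
    omega
  have hA2 : 1 - η ^ (2 : ℤ) ≠ 0 := by
    intro h
    have := Int.le_of_dvd (by norm_num) (hη1 2 (sub_eq_zero.mp h).symm)
    omega
  have hA3 : 1 - η ^ (3 : ℤ) ≠ 0 := by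
    intro h
    have := Int.le_of_dvd (by norm_num) (hη1 3 (sub_eq_zero.mp h).symm)
    omega
  have hkA : Dv R (1 - η ^ k) (1 - η) := by
    rcases hk with hk | hk
    · exact hcopdv k (Int.isCoprime_iff_gcd_eq_one.mpr hk)
    · rw [hηs] at hk
      simpa using hk.mul_left (R.sub_mem R.one_mem hηR1)
  have hP : Dv R ((1 - η) * (1 - η ^ (3 : ℤ))) ((1 - η ^ (k - 1)) * (1 - η ^ (k + 1))) := by
    have hcase : (3 : ℤ) ∣ k - 1 ∨ (3 : ℤ) ∣ k + 1 ∨ (3 : ℤ) ∣ k := by omega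
    rcases hcase with ⟨t, ht⟩ | ⟨t, ht⟩ | h
    · rw [mul_comm (1 - η)]
      refine Dv.mul ?_ (hdv1 _)
      rw [ht]; exact hdvz 3 t
    · refine Dv.mul (hdv1 _) ?_
      rw [ht]; exact hdvz 3 t
    · refine Dv.mul (hdv1 _) ((hcopdv 3 ?_).trans (hdv1 _))
      have hn3 : ¬ (3 : ℤ) ∣ N := fun h' => h3 ⟨h, h'⟩
      exact (Int.prime_three.coprime_iff_not_dvd).mpr hn3
  have hP2 : Dv R ((1 - η) * (1 - η ^ (3 : ℤ)))
      ((1 - η ^ ((2 : ℤ) - 1)) * (1 - η ^ ((2 : ℤ) + 1))) := by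
    norm_num
    exact Dv.refl _
  obtain ⟨w, hw⟩ : ∃ w, w = η ^ (2 : ℤ) / (1 - η ^ (2 : ℤ)) ^ 2 - η / (1 - η) ^ 2 := ⟨_, rfl⟩
  have hw' : w * ((1 - η ^ (2 : ℤ)) ^ 2 * (1 - η)) = -η * (1 - η ^ (3 : ℤ)) := by
    rw [hw]
    have e2 : η ^ (2 : ℤ) = η ^ 2 := by norm_cast
    have e3 : η ^ (3 : ℤ) = η ^ 3 := by norm_cast
    rw [e2] at hA2 ⊢
    rw [e3]
    field_simp
    ring
  have hw0 : w ≠ 0 := by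
    intro h
    rw [h, zero_mul] at hw'
    exact mul_ne_zero (neg_ne_zero.mpr hη0) hA3 hw'.symm
  have hwd : ∀ x, Dv R (1 - η ^ (3 : ℤ)) (x * ((1 - η ^ (2 : ℤ)) ^ 2 * (1 - η))) → Dv R w x := by
    rintro x ⟨r, hr, hx⟩
    refine ⟨-η⁻¹ * r, R.mul_mem (R.neg_mem (by simpa using hηR (-1))) hr, ?_⟩
    have hne : (1 - η ^ (2 : ℤ)) ^ 2 * (1 - η) ≠ 0 := mul_ne_zero (pow_ne_zero _ hA2) hA1
    apply mul_right_cancel₀ hne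
    rw [hx]
    calc (1 - η ^ (3 : ℤ)) * r = (-η * (1 - η ^ (3 : ℤ))) * (-η⁻¹ * r) := by field_simp
      _ = _ := by rw [← hw']; ring
  have hterm : ∀ s : ℤ, Dv R ((1 - η) * (1 - η ^ (3 : ℤ))) ((1 - η ^ (s - 1)) * (1 - η ^ (s + 1))) →
      ∀ j, Dv R w (Tz N (η ^ s) j - Tz N η j) := by
    intro s hs j
    apply Tz_sub
    intro n
    apply hwd
    have e : ((1 - (η ^ s) ^ (n : ℤ)) * (1 - (η ^ s) ^ (-(n : ℤ))) -
      (1 - η ^ (n : ℤ)) * (1 - η ^ (-(n : ℤ)))) =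
      η ^ (n : ℤ) * ((1 - η ^ ((s - 1) * n)) * (1 - η ^ ((s + 1) * (-n)))) := by
      rw [← zpow_mul, ← zpow_mul, show (s - 1) * (n : ℤ) = s * n + -n by ring,
        show (s + 1) * (-(n : ℤ)) = -(s * n) + -n by ring, mul_neg]
      rw [zpow_add₀ hη0, zpow_add₀ hη0, zpow_neg, zpow_neg]
      have h1 : η ^ (n : ℤ) ≠ 0 := zpow_ne_zero _ hη0
      have h2 : η ^ (s * n : ℤ) ≠ 0 := zpow_ne_zero _ hη0
      generalize η ^ (n : ℤ) = x at *
      generalize η ^ (s * n : ℤ) = y at *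
      field_simp
      ring
    rw [e]
    have h1 := hs.trans (Dv.mul (hdvz (s - 1) n) (hdvz (s + 1) (-n)))
    have h2 : Dv R (1 - η ^ (3 : ℤ)) ((1 - η) * (1 - η ^ (3 : ℤ))) :=
      (Dv.refl _).mul_left (R.sub_mem R.one_mem hηR1)
    have h3 := (h2.trans h1).mul_left (hηR n)
    have h4 := h3.mul_left (a := (1 - η ^ (2 : ℤ)) ^ 2 * (1 - η))
      (R.mul_mem (R.pow_mem (R.sub_mem R.one_mem (hηR 2)) 2) (R.sub_mem R.one_mem hηR1))
    rwa [mul_comm] at h4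
  have hcoef : ∀ s : ℤ, ∀ j, PowerSeries.coeff j (Phi N ζ c d s - Phi N ζ c d 1) =
      (if j = 0 then η ^ s / (1 - η ^ s) ^ 2 - η / (1 - η) ^ 2 else 0) -
        (Tz N (η ^ s) j - Tz N η j) := by
    intro s j
    rw [map_sub, Phi_coeff_dvd hN ζ c d s (hc.mul_left _), Phi_coeff_dvd hN ζ c d 1 (hc.mul_left _)]
    rw [hηs, hηs, zpow_one]
    split_ifs <;> ring
  have hck : Dv R w (η ^ k / (1 - η ^ k) ^ 2 - η / (1 - η) ^ 2) := by
    apply hwd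
    obtain ⟨r, hr, hr'⟩ := hkA
    obtain ⟨t, ht, ht'⟩ := hP
    have hk0 : 1 - η ^ k ≠ 0 := by
      intro h; rw [h, zero_mul] at hr'; exact hA1 hr'
    refine ⟨-η * t * (1 + η) ^ 2 * r ^ 2, ?_, ?_⟩
    · exact R.mul_mem (R.mul_mem (R.mul_mem (R.neg_mem hηR1) ht)
        (R.pow_mem (R.add_mem R.one_mem hηR1) 2)) (R.pow_mem hr 2)
    · have e1 : η ^ k / (1 - η ^ k) ^ 2 - η / (1 - η) ^ 2 =
          -η * ((1 - η ^ (k - 1)) * (1 - η ^ (k + 1))) / ((1 - η ^ k) ^ 2 * (1 - η) ^ 2) := by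
        rw [zpow_sub₀ hη0, zpow_add₀ hη0, zpow_one]
        generalize η ^ k = y at *
        field_simp
        ring
      rw [e1, ht', div_mul_eq_mul_div, div_eq_iff (mul_ne_zero (pow_ne_zero _ hk0)
        (pow_ne_zero _ hA1))]
      have e2 : (1 - η ^ (2 : ℤ)) = (1 - η) * (1 + η) := by
        have : η ^ (2 : ℤ) = η ^ 2 := by norm_cast
        rw [this]; ring
      rw [e2]
      generalize η ^ (3 : ℤ) = y3 at *
      have hr2 : (1 - η) ^ 2 = (1 - η ^ k) ^ 2 * r ^ 2 := by rw [← mul_pow, ← hr']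
      linear_combination (-η * (1 - y3) * t * (1 + η) ^ 2 * (1 - η) ^ 2) * hr2
  refine quot_coeff R _ _ 0 w hw0 (by simp) ?_ ?_ ?_
  · intro j
    rw [hcoef]
    refine Dv.sub ?_ (hterm 2 hP2 j)
    split_ifs
    · rw [← hw]; exact Dv.refl _
    · exact Dv.zero _
  · intro j
    rw [hcoef]
    refine Dv.sub ?_ (hterm k hP j)
    split_ifs
    · exact hck
    · exact Dv.zero _
  · rw [hcoef, Tz_zero (by omega), Tz_zero (by omega), if_pos rfl, ← hw]
    simpa using Dv.refl w

/-- The case `N ∤ c`. -/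
theorem case_ndvd {N : ℕ} (hN : 6 < N) {ζ : K} (hζ : IsPrimitiveRoot ζ N) (R : Subring K)
    (hR : ∀ z : ℤ, ζ ^ z ∈ R) (k : ℤ) (h3 : ¬ ((3 : ℤ) ∣ k ∧ (3 : ℤ) ∣ N))
    (a b c d : ℤ) (hA : a * d - b * c = 1) (hc : ¬ (N : ℤ) ∣ 1 * c)
    (hk : (N : ℤ) ∣ k * c → Dv R (1 - ζ ^ (k * d)) 1) :
    Phi N ζ c d 2 - Phi N ζ c d 1 ≠ 0 ∧
      ∀ i : ℤ,
        (((Phi N ζ c d k - Phi N ζ c d 1 : PowerSeries K) : LaurentSeries K) /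
            ((Phi N ζ c d 2 - Phi N ζ c d 1 : PowerSeries K) : LaurentSeries K)).coeff i ∈ R := by
  have hζ0 : ζ ≠ 0 := hζ.ne_zero (by omega)
  have hR' : ∀ z : ℤ, (ζ ^ z)⁻¹ ∈ R := fun z => by rw [← zpow_neg]; exact hR _
  have hint1 : ∀ j, PowerSeries.coeff j (Phi N ζ c d 1) ∈ R := Phi_int_ne hN R hR c d 1 hc
  have hintk : ∀ j, PowerSeries.coeff j (Phi N ζ c d k) ∈ R := by
    by_cases h : (N : ℤ) ∣ k * c
    · exact Phi_int_dvd hN R hR c d k h (hk h)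
    · exact Phi_int_ne hN R hR c d k h
  obtain ⟨hb1, hb1N⟩ := toNat_ne (by omega) hc
  have hΦ1 := coeff_Phi_ne N ζ c d 1 _ rfl hb1 hb1N
  by_cases h2 : (N : ℤ) ∣ 2 * c
  · have hΦ2 := Phi_coeff_dvd hN ζ c d 2 h2
    have hy1 : 1 - ζ ^ (2 * d) ≠ 0 := by
      intro h
      have h' := (hζ.zpow_eq_one_iff_dvd _).mp (sub_eq_zero.mp h).symm
      have h4 : (N : ℤ) ∣ 2 := by
        have : (2 : ℤ) = a * (2 * d) - b * (2 * c) := by linear_combination (-2) * hA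
        rw [this]
        exact dvd_sub (h'.mul_left _) (h2.mul_left _)
      have := Int.le_of_dvd (by norm_num) h4
      omega
    obtain ⟨y, hy⟩ : ∃ y, y = ζ ^ (2 * d) := ⟨_, rfl⟩
    have hyR : y ∈ R := by rw [hy]; exact hR _
    have hyR' : y⁻¹ ∈ R := by rw [hy]; exact hR' _
    have hy0 : y ≠ 0 := by rw [hy]; exact zpow_ne_zero _ hζ0
    rw [← hy] at hy1 hΦ2
    have hdv : ∀ x ∈ R, Dv R (y / (1 - y) ^ 2) x := by
      intro x hx
      refine ⟨(1 - y) ^ 2 * y⁻¹ * x, R.mul_mem (R.mul_mem (R.pow_mem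
        (R.sub_mem R.one_mem hyR) 2) hyR') hx, ?_⟩
      field_simp
    refine quot_coeff R _ _ 0 (y / (1 - y) ^ 2) (div_ne_zero hy0 (pow_ne_zero _ hy1))
      (by simp) ?_ ?_ ?_
    · intro j
      rw [map_sub, hΦ2]
      refine Dv.sub (Dv.sub ?_ (hdv _ (Tz_mem hyR hyR' j))) (hdv _ (hint1 j))
      split_ifs
      · exact Dv.refl _
      · exact Dv.zero _
    · intro j
      rw [map_sub]
      exact hdv _ (R.sub_mem (hintk j) (hint1 j))
    · rw [map_sub, hΦ2, hΦ1, Tn_low hb1N hb1, Tz_zero (by omega), if_pos rfl]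
      simpa using Dv.refl _
  obtain ⟨hb2, hb2N⟩ := toNat_ne (by omega) h2
  have hΦ2 := coeff_Phi_ne N ζ c d 2 _ rfl hb2 hb2N
  have hint2 : ∀ j, PowerSeries.coeff j (Phi N ζ c d 2) ∈ R := Phi_int_ne hN R hR c d 2 h2
  have hunit : ∀ z : ℤ, Dv R (ζ ^ z) 1 := fun z =>
    ⟨_, hR' z, (mul_inv_cancel₀ (zpow_ne_zero _ hζ0)).symm⟩
  by_cases hne : (Ibr N (1 * c)).toNat = (Ibr N (2 * c)).toNat
  · -- the case `3c ≡ 0`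
    have e12 : Ibr N (1 * c) = Ibr N (2 * c) := by
      have := Ibr_nonneg (by omega : 0 < N) (1 * c)
      have := Ibr_nonneg (by omega : 0 < N) (2 * c)
      omega
    have h3c : (N : ℤ) ∣ 3 * c := by
      have d1 := dvd_sub_Imu N (1 * c)
      have d2 := dvd_sub_Imu N (2 * c)
      rw [← e12] at d2
      set B := Ibr N (1 * c)
      by_cases hμ : Imu N (2 * c) = Imu N (1 * c)
      · exfalso
        apply hc
        rw [hμ] at d2
        have : 1 * c = (2 * c - Imu N (1 * c) * B) - (1 * c - Imu N (1 * c) * B) := by ring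
        rw [this]
        exact dvd_sub d2 d1
      · have hμ' : Imu N (2 * c) = - Imu N (1 * c) := by
          rcases Imu_cases N (1 * c) with h | h <;> rcases Imu_cases N (2 * c) with h' | h' <;>
            omega
        rw [hμ'] at d2
        have : 3 * c = (2 * c - -Imu N (1 * c) * B) + (1 * c - Imu N (1 * c) * B) := by ring
        rw [this]
        exact dvd_add d2 d1
    have h3N : (3 : ℤ) ∣ N := by
      by_contra h
      have hcop : IsCoprime (3 : ℤ) N := (Int.prime_three.coprime_iff_not_dvd).mpr h
      apply hc
      rw [one_mul]
      exact hcop.symm.dvd_of_dvd_mul_left h3c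
    have h3k : ¬ (3 : ℤ) ∣ k := fun h => h3 ⟨h, h3N⟩
    obtain ⟨ε, hε, hεk⟩ : ∃ ε : ℤ, (ε = 1 ∨ ε = -1) ∧ 3 ∣ k - ε := by
      have : (3 : ℤ) ∣ k - 1 ∨ (3 : ℤ) ∣ k - (-1) := by omega
      rcases this with h | h
      · exact ⟨1, Or.inl rfl, h⟩
      · exact ⟨-1, Or.inr rfl, h⟩
    obtain ⟨hlt, -, hμ2⟩ := three_case hN (s := 2) (ε := -1) h3c hc (Or.inr rfl) (by norm_num)
    obtain ⟨-, hbk, hμk⟩ := three_case hN (s := k) (ε := ε) h3c hc hε hεk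
    have hΦk := coeff_Phi_ne N ζ c d k _ (by rw [hbk]) hb1 hb1N
    rw [← hne] at hΦ2
    have hltn : 2 * (Ibr N (1 * c)).toNat < N := by omega
    obtain ⟨B, hB⟩ : ∃ B, B = (Ibr N (1 * c)).toNat := ⟨_, rfl⟩
    have hμ1 := Imu_cases N (1 * c)
    obtain ⟨μ, hμ⟩ : ∃ μ, μ = Imu N (1 * c) := ⟨_, rfl⟩
    rw [← hμ] at hμ1 hμ2 hμk hΦ1
    rw [hμ2, ← hB] at hΦ2
    rw [hμk, ← hB] at hΦk
    rw [← hB] at hΦ1 hltn hb1 hb1N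
    obtain ⟨y, hy⟩ : ∃ y, y = ζ ^ (μ * 1 * d) := ⟨_, rfl⟩
    obtain ⟨ω, hω⟩ : ∃ ω, ω = ζ ^ (-3 * μ * d) := ⟨_, rfl⟩
    have hy0 : y ≠ 0 := by rw [hy]; exact zpow_ne_zero _ hζ0
    have hω0 : ω ≠ 0 := by rw [hω]; exact zpow_ne_zero _ hζ0
    have hyR : y ∈ R := by rw [hy]; exact hR _
    have hyR' : y⁻¹ ∈ R := by rw [hy]; exact hR' _
    have hωR : ω ∈ R := by rw [hω]; exact hR _
    have hωR' : ω⁻¹ ∈ R := by rw [hω]; exact hR' _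
    have hω1 : 1 - ω ≠ 0 := by
      intro h
      have h' := (hζ.zpow_eq_one_iff_dvd _).mp (hω ▸ (sub_eq_zero.mp h).symm)
      have h4 : (N : ℤ) ∣ 3 := by
        have hsq : μ * μ = 1 := by rcases hμ1 with h | h <;> rw [h] <;> norm_num
        have : (3 : ℤ) = (-μ * a) * (-3 * μ * d) - b * (3 * c) := by
          linear_combination (-3) * hA - 3 * a * d * hsq
        rw [this]
        exact dvd_sub (h'.mul_left _) (h3c.mul_left _)
      have := Int.le_of_dvd (by norm_num) h4
      omega
    have hy2 : ζ ^ (-1 * μ * 2 * d) = y * ω := by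
      rw [hy, hω, ← zpow_add₀ hζ0]; congr 1; ring
    obtain ⟨t, ht⟩ : ∃ t : ℤ, ε * k = 1 + 3 * t := by
      obtain ⟨u, hu⟩ := hεk
      refine ⟨ε * u, ?_⟩
      have hsq : ε * ε = 1 := by rcases hε with h | h <;> rw [h] <;> norm_num
      linear_combination ε * hu + hsq
    have hyk : ζ ^ (ε * μ * k * d) = y * ω ^ (-t) := by
      rw [hy, hω, ← zpow_mul, ← zpow_add₀ hζ0]; congr 1
      linear_combination (μ * d) * ht
    rw [← hy] at hΦ1
    rw [hy2] at hΦ2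
    rw [hyk] at hΦk
    have hdv : ∀ z n : ℤ, Dv R (y * (1 - ω)) ((y * ω ^ z) ^ n - y ^ n) := by
      intro z n
      obtain ⟨r, hr, hr'⟩ := Dv.one_sub_zpow hω0 hωR hωR' (z * n)
      refine ⟨- y ^ (n - 1) * r, R.mul_mem (R.neg_mem (mem_zpow hyR hyR' _)) hr, ?_⟩
      rw [mul_zpow, ← zpow_mul, zpow_sub₀ hy0, zpow_one]
      have : y ^ n * ω ^ (z * n) - y ^ n = - y ^ n * (1 - ω ^ (z * n)) := by ring
      rw [this, hr']
      field_simp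
    have hdv1 : ∀ n : ℤ, Dv R (y * (1 - ω)) ((y * ω) ^ n - y ^ n) := by
      intro n
      simpa using hdv 1 n
    refine quot_coeff R _ _ B (y * (1 - ω)) (mul_ne_zero hy0 hω1) ?_ ?_ ?_ ?_
    · intro j hj
      rw [map_sub, hΦ1, hΦ2, Tn_low hb1N hj, Tn_low hb1N hj, sub_zero]
    · intro j
      rw [map_sub, hΦ1, hΦ2]
      exact Tn_sub j hdv1
    · intro j
      rw [map_sub, hΦ1, hΦk]
      exact Tn_sub j (hdv (-t))
    · rw [map_sub, hΦ1, hΦ2, Tn_lead hb1 hltn, Tn_lead hb1 hltn]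
      exact ⟨-1, R.neg_mem R.one_mem, by ring⟩
  · -- the generic case
    have hD : ∀ j, Dv R 1 (PowerSeries.coeff j (Phi N ζ c d 2 - Phi N ζ c d 1)) := fun j =>
      Dv.one_iff.mpr (by rw [map_sub]; exact R.sub_mem (hint2 j) (hint1 j))
    have hE : ∀ j, Dv R 1 (PowerSeries.coeff j (Phi N ζ c d k - Phi N ζ c d 1)) := fun j =>
      Dv.one_iff.mpr (by rw [map_sub]; exact R.sub_mem (hintk j) (hint1 j))
    rcases lt_or_gt_of_ne hne with hlt | hlt
    · refine quot_coeff R _ _ (Ibr N (1 * c)).toNat 1 one_ne_zero ?_ hD hE ?_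
      · intro j hj
        rw [map_sub, hΦ1, hΦ2, Tn_low hb1N hj, Tn_low hb2N (by omega), sub_zero]
      · rw [map_sub, hΦ1, hΦ2, Tn_lead hb1 (by omega), Tn_low hb2N hlt, zero_sub]
        obtain ⟨r, hr, hr'⟩ := hunit (Imu N (1 * c) * 1 * d)
        exact ⟨-r, R.neg_mem hr, by rw [neg_mul_neg]; exact hr'⟩
    · refine quot_coeff R _ _ (Ibr N (2 * c)).toNat 1 one_ne_zero ?_ hD hE ?_
      · intro j hj
        rw [map_sub, hΦ1, hΦ2, Tn_low hb1N (by omega), Tn_low hb2N hj, sub_zero]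
      · rw [map_sub, hΦ1, hΦ2, Tn_lead hb2 (by omega), Tn_low hb1N hlt, sub_zero]
        exact hunit _

end main2

/-- Proposition 6: let `2 < k < N/2`, `δ = gcd(k,N)`, and assume (i) `δ = 1`, or (ii) `δ > 1`,
`gcd(δ,3) = 1` and `N/δ` is not a prime power. Then for every `A = (a b; c d) ∈ SL₂(ℤ)` the
q-expansion of `Λ_{k,2}∘A`, namely `(Φ_k(A) − Φ_1(A))/(Φ_2(A) − Φ_1(A))` formed in
`ℚ(ζ)((q))`, has all coefficients in `ℤ[ζ]`. -/
theorem statement12 (N : ℕ) (hN : 6 < N) {K : Type*} [Field K] (ζ : K)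
    (hζ : IsPrimitiveRoot ζ N) (k : ℤ) (hk1 : 2 < k) (hk2 : 2 * k < (N : ℤ))
    (hδ : Int.gcd k N = 1 ∨
      (1 < Int.gcd k N ∧ Nat.gcd (Int.gcd k N) 3 = 1 ∧
        ∃ p q : ℕ, p.Prime ∧ q.Prime ∧ p ≠ q ∧
          p ∣ N / Int.gcd k N ∧ q ∣ N / Int.gcd k N))
    (a b c d : ℤ) (hA : a * d - b * c = 1) :
    Phi N ζ c d 2 - Phi N ζ c d 1 ≠ 0 ∧
      ∀ i : ℤ,
        (((Phi N ζ c d k - Phi N ζ c d 1 : PowerSeries K) : LaurentSeries K) /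
            ((Phi N ζ c d 2 - Phi N ζ c d 1 : PowerSeries K) : LaurentSeries K)).coeff i ∈
          Subring.closure {ζ} := by
  have hζ0 : ζ ≠ 0 := hζ.ne_zero (by omega)
  have hζR : ζ ∈ Subring.closure {ζ} := Subring.subset_closure rfl
  have hζR' : ζ⁻¹ ∈ Subring.closure {ζ} := by
    have : ζ⁻¹ = ζ ^ (N - 1) := by
      apply inv_eq_of_mul_eq_one_right
      rw [← pow_succ', Nat.sub_add_cancel (by omega), hζ.pow_eq_one]
    rw [this]
    exact Subring.pow_mem _ hζR _
  have hR : ∀ z : ℤ, ζ ^ z ∈ Subring.closure {ζ} := fun z => mem_zpow hζR hζR' z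
  have h3 : ¬ ((3 : ℤ) ∣ k ∧ (3 : ℤ) ∣ N) := by
    rintro ⟨h, h'⟩
    have h4 : 3 ∣ Int.gcd k N := by
      have := Int.dvd_coe_gcd h h'
      exact_mod_cast this
    rcases hδ with h1 | ⟨-, h1, -⟩
    · rw [h1] at h4; omega
    · have := Nat.dvd_gcd h4 (dvd_refl 3)
      rw [h1] at this; omega
  by_cases hc : (N : ℤ) ∣ c
  · refine case_dvd hN hζ _ hR k h3 a b c d hA hc ?_
    rcases hδ with h | ⟨-, -, h⟩
    · exact Or.inl h
    · exact Or.inr (unit_k hN hζ _ hR h hA (hc.mul_left _))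
  · refine case_ndvd hN hζ _ hR k h3 a b c d hA (by rwa [one_mul]) ?_
    intro hkc
    rcases hδ with h | ⟨-, -, h⟩
    · exfalso
      exact hc ((Int.isCoprime_iff_gcd_eq_one.mpr h).symm.dvd_of_dvd_mul_left hkc)
    · exact unit_k hN hζ _ hR h hA hkc
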